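/- Let E be a pseudo-effect algebra, c a central element of E, and (eᵢ)_{i∈I} a family of elements of E. Then: (i) if ⋁_{i∈I} eᵢ exists in E, then c ∧ ⋁_{i∈I} eᵢ = ⋁_{i∈I}(c ∧ eᵢ); (ii) for every e ∈ E, c = (c ∧ e) + (c ∧ e∼). -/

import Mathlib

namespace PEApaper

/-- The bare data of a partial-addition structure: a partial binary operation
(encoded via `Option`) together with constants `0` and `1`. -/
structure PartialStruct (E : Type) where
  padd : E → E → Option E
  zero : E
  one : E

namespace PartialStruct

variable {E : Type}

/-- `a ≤ b` iff `a + c = b` for some `c`. -/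
def le (P : PartialStruct E) (a b : E) : Prop := ∃ c, P.padd a c = some b

/-- `m` is the greatest lower bound (meet `a ∧ b`) of `a` and `b`. -/
def IsMeet (P : PartialStruct E) (a b m : E) : Prop :=
  P.le m a ∧ P.le m b ∧ ∀ x, P.le x a → P.le x b → P.le x m

/-- `j` is the least upper bound (join `a ∨ b`) of `a` and `b`. -/
def IsJoin (P : PartialStruct E) (a b j : E) : Prop :=
  P.le a j ∧ P.le b j ∧ ∀ x, P.le a x → P.le b x → P.le j x

/-- `s` is the supremum of the set `S`. -/
def IsSup (P : PartialStruct E) (S : Set E) (s : E) : Prop :=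
  (∀ x ∈ S, P.le x s) ∧ ∀ u, (∀ x ∈ S, P.le x u) → P.le s u

/-- Left-associated partial sum of a list, continuing from `acc`. -/
def IsSumFrom (P : PartialStruct E) : E → List E → E → Prop
  | acc, [], s => s = acc
  | acc, a :: l, s => ∃ t, P.padd acc a = some t ∧ IsSumFrom P t l s

/-- `s` is the (left-associated) orthosum `e₁ + e₂ + ⋯ + eₙ` of the list. -/
def IsSumList (P : PartialStruct E) (l : List E) (s : E) : Prop :=
  match l with
  | [] => s = P.zero
  | a :: t => IsSumFrom P a t s

/-- `c` is a central element: there is a PEA-isomorphism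
`f : E → E[0,c] × E[0,c∼]` with `f c = (c,0)` such that `f x = (x₁,x₂)`
implies `x = x₁ + x₂`.  The isomorphism onto the product of the two
interval pseudo-effect algebras is spelled out explicitly. -/
def IsCentral (P : PartialStruct E) (c : E) : Prop :=
  ∃ cs, P.padd c cs = some P.one ∧
    ∃ f : E → E × E,
      (∀ x, P.le (f x).1 c ∧ P.le (f x).2 cs) ∧
      Function.Injective f ∧
      (∀ y : E × E, P.le y.1 c → P.le y.2 cs → ∃ x, f x = y) ∧
      f c = (c, P.zero) ∧
      f P.one = (c, cs) ∧
      (∀ x, P.padd (f x).1 (f x).2 = some x) ∧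
      (∀ a b ab, P.padd a b = some ab →
        P.padd (f a).1 (f b).1 = some (f ab).1 ∧
        P.padd (f a).2 (f b).2 = some (f ab).2) ∧
      (∀ a b s t, P.padd (f a).1 (f b).1 = some s → P.le s c →
        P.padd (f a).2 (f b).2 = some t → P.le t cs →
        ∃ ab, P.padd a b = some ab)

/-- The center `Γ(E)`. -/
def center (P : PartialStruct E) : Set E := {c | P.IsCentral c}

/-- The central interval `Γ(E)[0,c] = Γ(E) ∩ E[0,c]`. -/
def centerIntervalSet (P : PartialStruct E) (c : E) : Set E :=
  {x | P.IsCentral x ∧ P.le x c}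

/-- A Γ-orthogonal family: one dominated elementwise by a pairwise
disjoint family of central elements. -/
def GammaOrthogonal (P : PartialStruct E) {I : Type} (e : I → E) : Prop :=
  ∃ c : I → E, (∀ i, P.IsCentral (c i)) ∧
    (∀ i j, i ≠ j → P.IsMeet (c i) (c j) P.zero) ∧
    ∀ i, P.le (e i) (c i)

/-- Centrally orthocomplete: every Γ-orthogonal family has a supremum. -/
def IsCOPEA (P : PartialStruct E) : Prop :=
  ∀ (I : Type) (e : I → E), P.GammaOrthogonal e → ∃ s, P.IsSup (Set.range e) s

/-- `c` is the central cover of `e`: the smallest central element above `e`. -/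
def IsCentralCover (P : PartialStruct E) (c e : E) : Prop :=
  P.IsCentral c ∧ P.le e c ∧ ∀ d, P.IsCentral d → P.le e d → P.le c d

/-- `[Q]`: the set of all suprema of Γ-orthogonal families of elements of `Q`. -/
def bra (P : PartialStruct E) (Q : Set E) : Set E :=
  {s | ∃ (I : Type) (e : I → E), (∀ i, e i ∈ Q) ∧ P.GammaOrthogonal e ∧
    P.IsSup (Set.range e) s}

/-- `Q^γ = {q ∧ c : q ∈ Q, c ∈ Γ(E)}`. -/
def gammaClosure (P : PartialStruct E) (Q : Set E) : Set E :=
  {m | ∃ q ∈ Q, ∃ c, P.IsCentral c ∧ P.IsMeet q c m}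

/-- `Q↓ = ⋃_{q ∈ Q} E[0,q]`. -/
def downSet (P : PartialStruct E) (Q : Set E) : Set E :=
  {e | ∃ q ∈ Q, P.le e q}

/-- `Q' = {e ∈ E : q ∧ e = 0 for all q ∈ Q}`. -/
def commutant (P : PartialStruct E) (Q : Set E) : Set E :=
  {e | ∀ q ∈ Q, P.IsMeet q e P.zero}

/-- A type-determining (TD) set: `K = [K] = K^γ`. -/
def IsTD (P : PartialStruct E) (K : Set E) : Prop :=
  P.bra K = K ∧ P.gammaClosure K = K

/-- A strongly type-determining (STD) set: `K = [K] = K↓`. -/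
def IsSTD (P : PartialStruct E) (K : Set E) : Prop :=
  P.bra K = K ∧ P.downSet K = K

/-- `c` is the type-cover of `K` (w.r.t. the central cover map `γ`):
the unique central element with `γK = Γ(E)[0,c]`. -/
def IsTypeCover (P : PartialStruct E) (γ : E → E) (K : Set E) (c : E) : Prop :=
  P.IsCentral c ∧ γ '' K = P.centerIntervalSet c

/-- An atom: a nonzero element with no proper nonzero subelement. -/
def IsAtom' (P : PartialStruct E) (a : E) : Prop :=
  a ≠ P.zero ∧ ∀ x, P.le x a → x = P.zero ∨ x = a

end PartialStruct

/-- A PEA-isomorphism between two partial-addition structures: a bijective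
morphism whose inverse is a morphism. -/
structure IsPEAIso {A B : Type} (P : PartialStruct A) (Q : PartialStruct B)
    (f : A → B) : Prop where
  bijective : Function.Bijective f
  map_one : f P.one = Q.one
  map_add : ∀ a b ab, P.padd a b = some ab → Q.padd (f a) (f b) = some (f ab)
  rev_add : ∀ a b s, Q.padd (f a) (f b) = some s → ∃ ab, P.padd a b = some ab

open scoped Classical in
/-- The (coordinatewise) product of a family of partial structures. -/
noncomputable def prodStruct {I : Type} {A : I → Type}
    (Ps : ∀ i, PartialStruct (A i)) : PartialStruct (∀ i, A i) where
  padd a b :=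
    if h : ∀ i, ∃ s, (Ps i).padd (a i) (b i) = some s
    then some fun i => Classical.choose (h i)
    else none
  zero := fun i => (Ps i).zero
  one := fun i => (Ps i).one

/-- A pseudo-effect algebra. -/
structure PEA (E : Type) extends PartialStruct E where
  assoc_def : ∀ a b c : E,
    (∃ ab, padd a b = some ab ∧ ∃ x, padd ab c = some x) ↔
    (∃ bc, padd b c = some bc ∧ ∃ y, padd a bc = some y)
  assoc_eq : ∀ a b c ab bc x y, padd a b = some ab → padd ab c = some x →
    padd b c = some bc → padd a bc = some y → x = y
  exu_right : ∀ a : E, ∃! d, padd a d = some one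
  exu_left : ∀ a : E, ∃! e, padd e a = some one
  shift : ∀ a b ab, padd a b = some ab →
    (∃ d, padd d a = some ab) ∧ (∃ e, padd b e = some ab)
  one_add : ∀ a x, padd one a = some x → a = zero
  add_one : ∀ a x, padd a one = some x → a = zero

namespace PEA

variable {E : Type} (P : PEA E)

/-- Shorthand for the underlying partial structure. -/
abbrev ps : PartialStruct E := P.toPartialStruct

theorem one_add_zero : P.padd P.one P.zero = some P.one := by
  obtain ⟨d, hd, -⟩ := P.exu_right P.one
  have h := P.one_add d P.one hd
  rwa [h] at hd

theorem zero_add_one : P.padd P.zero P.one = some P.one := by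
  obtain ⟨e, he, -⟩ := P.exu_left P.one
  have h := P.add_one e P.one he
  rwa [h] at he

theorem padd_zero (a : E) : P.padd a P.zero = some a := by
  obtain ⟨e, he, -⟩ := P.exu_left a
  have h1 : ∃ ab, P.padd e a = some ab ∧ ∃ x, P.padd ab P.zero = some x :=
    ⟨P.one, he, P.one, P.one_add_zero⟩
  obtain ⟨t, ht, y, hy⟩ := (P.assoc_def e a P.zero).mp h1
  have hxy : P.one = y :=
    P.assoc_eq e a P.zero P.one t P.one y he P.one_add_zero ht hy
  obtain ⟨d, hd, hu⟩ := P.exu_right e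
  have hta : t = a := by
    have h2 : t = d := hu t (by rw [← hxy] at hy; exact hy)
    have h3 : a = d := hu a he
    rw [h2, h3]
  rwa [hta] at ht

theorem zero_padd (a : E) : P.padd P.zero a = some a := by
  obtain ⟨d, hd, -⟩ := P.exu_right a
  have h1 : ∃ bc, P.padd a d = some bc ∧ ∃ y, P.padd P.zero bc = some y :=
    ⟨P.one, hd, P.one, P.zero_add_one⟩
  obtain ⟨t, ht, y, hy⟩ := (P.assoc_def P.zero a d).mpr h1
  have hxy : y = P.one :=
    P.assoc_eq P.zero a d t P.one y P.one ht hy hd P.zero_add_one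
  obtain ⟨e, he, hu⟩ := P.exu_left d
  have hta : t = a := by
    have h2 : t = e := hu t (by rw [hxy] at hy; exact hy)
    have h3 : a = e := hu a hd
    rw [h2, h3]
  rwa [hta] at ht

theorem zero_le (a : E) : P.ps.le P.zero a := ⟨a, P.zero_padd a⟩

theorem le_refl (a : E) : P.ps.le a a := ⟨P.zero, P.padd_zero a⟩

open scoped Classical in
/-- The interval pseudo-effect algebra `E[0,p]` as a partial structure on
the subtype `{x // x ≤ p}`; the sum is defined iff it is defined in `E`
and lies below `p`, and the unit is `p`. -/
noncomputable def intervalStruct (p : E) :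
    PartialStruct {x : E // P.ps.le x p} where
  padd a b := (P.padd a.1 b.1).bind fun s =>
    if h : P.ps.le s p then some ⟨s, h⟩ else none
  zero := ⟨P.zero, P.zero_le p⟩
  one := ⟨p, P.le_refl p⟩

end PEA

/-- The order relation of a complete Boolean algebra structure, made explicit. -/
def cbaLe {X : Type} (inst : CompleteBooleanAlgebra X) (a b : X) : Prop :=
  @LE.le X (by letI := inst; exact inferInstance) a b

end PEApaper

namespace PEApaper.PEA

variable {E : Type} (P : PEA E)

theorem le_trans {a b c : E} (hab : P.ps.le a b) (hbc : P.ps.le b c) : P.ps.le a c := by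
  obtain ⟨d, hd⟩ := hab
  obtain ⟨k, hk⟩ := hbc
  obtain ⟨t, ht, y, hy⟩ := (P.assoc_def a d k).mp ⟨b, hd, c, hk⟩
  obtain rfl := P.assoc_eq a d k b t c y hd hk ht hy
  exact ⟨t, hy⟩

theorem right_le {a b s : E} (h : P.padd a b = some s) : P.ps.le b s :=
  (P.shift a b s h).2

theorem eq_zero_of_padd_eq_zero {a b : E} (h : P.padd a b = some P.zero) : a = P.zero := by
  obtain ⟨x, hx, -⟩ := (P.assoc_def P.one a b).mpr ⟨P.zero, h, P.one, P.one_add_zero⟩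
  exact P.one_add a x hx

end PEApaper.PEA

open PEApaper PEApaper.PartialStruct in
/-- Theorem 3.11: for a central element `c`:
(i) if `⋁ᵢ eᵢ` exists then `c ∧ ⋁ᵢ eᵢ = ⋁ᵢ (c ∧ eᵢ)`;
(ii) for every `e`, `c = (c ∧ e) + (c ∧ e∼)`. -/
theorem stmt3 {E : Type} (P : PEA E) (c : E) (hc : P.ps.IsCentral c) :
    (∀ (I : Type) (e : I → E) (s : E), P.ps.IsSup (Set.range e) s →
      ∃ m : I → E, (∀ i, P.ps.IsMeet c (e i) (m i)) ∧
        ∃ t, P.ps.IsMeet c s t ∧ P.ps.IsSup (Set.range m) t) ∧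
    (∀ e es, P.ps.padd e es = some P.ps.one →
      ∃ m₁ m₂, P.ps.IsMeet c e m₁ ∧ P.ps.IsMeet c es m₂ ∧
        P.ps.padd m₁ m₂ = some c) := by
  obtain ⟨cs, -, f, hle, hinj, hsurj, hfc, hf1, hsum, hadd, hrev⟩ := hc
  have hmono : ∀ x y, P.ps.le x y → P.ps.le (f x).1 (f y).1 := by
    rintro x y ⟨d, hd⟩
    exact ⟨_, (hadd _ _ _ hd).1⟩
  have hfst : ∀ x, P.ps.le (f x).1 x := fun x => ⟨_, hsum x⟩
  have hbelow : ∀ y, P.ps.le y c → (f y).1 = y := by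
    rintro y ⟨d, hd⟩
    have h2 := (hadd _ _ _ hd).2
    rw [hfc] at h2
    have h3 := hsum y
    rw [P.eq_zero_of_padd_eq_zero h2] at h3
    exact Option.some.inj ((P.padd_zero _).symm.trans h3)
  have hmeet : ∀ x, P.ps.IsMeet c x (f x).1 := by
    refine fun x => ⟨(hle x).1, hfst x, fun y hyc hyx => ?_⟩
    have h := hmono y x hyx
    rwa [hbelow y hyc] at h
  refine ⟨fun I e s hs => ⟨fun i => (f (e i)).1, fun i => hmeet _, (f s).1, hmeet _, ?_, ?_⟩,
    fun e es h => ⟨_, _, hmeet e, hmeet es, ?_⟩⟩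
  · rintro _ ⟨i, rfl⟩
    exact hmono _ _ (hs.1 _ ⟨i, rfl⟩)
  · intro u hu
    obtain ⟨w, hw⟩ := hsurj ((f u).1, cs) (hle u).1 (P.le_refl cs)
    have hsw : P.ps.le s w := by
      apply hs.2
      rintro _ ⟨i, rfl⟩
      have hiu := hmono _ _ (hu _ ⟨i, rfl⟩)
      rw [hbelow _ (hle (e i)).1] at hiu
      obtain ⟨a, ha⟩ := hiu
      obtain ⟨b, hb⟩ := (hle (e i)).2
      obtain ⟨z, hz⟩ := hsurj (a, b) (P.le_trans (P.right_le ha) (hle u).1) (P.right_le hb)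
      have haz : P.padd (f (e i)).1 (f z).1 = some (f u).1 := by rw [hz]; exact ha
      have hbz : P.padd (f (e i)).2 (f z).2 = some cs := by rw [hz]; exact hb
      obtain ⟨v, hv⟩ := hrev _ _ _ _ haz (hle u).1 hbz (P.le_refl cs)
      obtain ⟨h1, h2⟩ := hadd _ _ _ hv
      have hvw : v = w := by
        apply hinj
        rw [hw]
        exact Prod.ext (Option.some.inj (h1.symm.trans haz)) (Option.some.inj (h2.symm.trans hbz))
      exact ⟨z, hvw ▸ hv⟩
    have h := hmono _ _ hsw
    rw [hw] at h
    exact P.le_trans h (hfst u)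
  · have h1 := (hadd _ _ _ h).1
    rwa [hf1] at h1
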